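/- arXiv:2105.06201 — 2 statements merged into one kernel-verified Lean document; each statement's English description precedes it below -/
import Mathlib

section
/- Let σ^n and σ^m be encoding strategies at blocklengths n and m (with message alphabets M1^n×M2^n and M1^m×M2^m respectively), and let σ_c be their concatenation at blocklength n+m, with message alphabets M1^n×M1^m and M2^n×M2^m, defined by σ_c((a,a'),(b,b') | u^{n+m}) = σ^n(a,b | u_1^n)·σ^m(a',b' | u_{n+1}^{n+m}). For i = 1,2, if τ_i^n ∈ BR_i(σ^n) and τ_i^m ∈ BR_i(σ^m), then the concatenated decoding strategy τ_{i,c}, which applies τ_i^n to the first message components to produce V_i^n on the first n stages and τ_i^m to the second components on the last m stages (independently), is a best response to σ_c: τ_{i,c} ∈ BR_i(σ_c), where BR_i is defined with respect to the (n+m)-stage long-run distortion d_i^{n+m}. -/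
open scoped BigOperators

namespace Persuasion

/-- `p` is a probability distribution on the finite alphabet `α`. -/
def IsDist {α : Type*} [Fintype α] (p : α → ℝ) : Prop :=
  (∀ a, 0 ≤ p a) ∧ ∑ a, p a = 1

/-- `k` is a stochastic map (transition kernel) from `α` to `β`. -/
def IsKernel {α : Type*} {β : Type*} [Fintype β] (k : α → β → ℝ) : Prop :=
  ∀ a, IsDist (k a)

/-- Shannon entropy (in bits) of a distribution on a finite alphabet. -/
noncomputable def ent {α : Type*} [Fintype α] (p : α → ℝ) : ℝ :=
  - ∑ a, p a * Real.logb 2 (p a)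

/-- Mutual information (in bits) computed from a joint distribution on `α × β`. -/
noncomputable def miOfJoint {α β : Type*} [Fintype α] [Fintype β] (p : α × β → ℝ) : ℝ :=
  ent (fun a => ∑ b, p (a, b)) + ent (fun b => ∑ a, p (a, b)) - ent p

/-- Message alphabet `{1, …, 2^⌊n·R⌋}` at rate `R` and blocklength `n`. -/
abbrev Msg (R : ℝ) (n : ℕ) : Type := Fin (2 ^ ⌊(n : ℝ) * R⌋₊)

section Operational

variable {U V1 V2 M1 M2 : Type*} [Fintype U] [Fintype V1] [Fintype V2]
  [Fintype M1] [Fintype M2]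

/-- Long-run encoder distortion `d_e^n(σ,τ1,τ2)`. -/
noncomputable def deN (PU : U → ℝ) (de : U → V1 → V2 → ℝ) {n : ℕ}
    (σ : (Fin n → U) → M1 × M2 → ℝ)
    (τ1 : M1 × M2 → (Fin n → V1) → ℝ)
    (τ2 : M2 → (Fin n → V2) → ℝ) : ℝ :=
  ∑ un : Fin n → U, ∑ m1 : M1, ∑ m2 : M2, ∑ v1n : Fin n → V1, ∑ v2n : Fin n → V2,
    ((∏ t, PU (un t)) * σ un (m1, m2) * τ1 (m1, m2) v1n * τ2 m2 v2n) *
      ((n : ℝ)⁻¹ * ∑ t, de (un t) (v1n t) (v2n t))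

/-- Long-run distortion `d_1^n(σ,τ1)` of the first decoder. -/
noncomputable def d1N (PU : U → ℝ) (d1 : U → V1 → ℝ) {n : ℕ}
    (σ : (Fin n → U) → M1 × M2 → ℝ)
    (τ1 : M1 × M2 → (Fin n → V1) → ℝ) : ℝ :=
  ∑ un : Fin n → U, ∑ m1 : M1, ∑ m2 : M2, ∑ v1n : Fin n → V1,
    ((∏ t, PU (un t)) * σ un (m1, m2) * τ1 (m1, m2) v1n) *
      ((n : ℝ)⁻¹ * ∑ t, d1 (un t) (v1n t))

/-- Long-run distortion `d_2^n(σ,τ2)` of the second decoder. -/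
noncomputable def d2N (PU : U → ℝ) (d2 : U → V2 → ℝ) {n : ℕ}
    (σ : (Fin n → U) → M1 × M2 → ℝ)
    (τ2 : M2 → (Fin n → V2) → ℝ) : ℝ :=
  ∑ un : Fin n → U, ∑ m1 : M1, ∑ m2 : M2, ∑ v2n : Fin n → V2,
    ((∏ t, PU (un t)) * σ un (m1, m2) * τ2 m2 v2n) *
      ((n : ℝ)⁻¹ * ∑ t, d2 (un t) (v2n t))

/-- Best responses of decoder 1 to the encoding strategy `σ`. -/
def BR1 (PU : U → ℝ) (d1 : U → V1 → ℝ) {n : ℕ}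
    (σ : (Fin n → U) → M1 × M2 → ℝ) :
    Set (M1 × M2 → (Fin n → V1) → ℝ) :=
  {τ1 | IsKernel τ1 ∧ ∀ τ1' : M1 × M2 → (Fin n → V1) → ℝ,
      IsKernel τ1' → d1N PU d1 σ τ1 ≤ d1N PU d1 σ τ1'}

/-- Best responses of decoder 2 to the encoding strategy `σ`. -/
def BR2 (PU : U → ℝ) (d2 : U → V2 → ℝ) {n : ℕ}
    (σ : (Fin n → U) → M1 × M2 → ℝ) :
    Set (M2 → (Fin n → V2) → ℝ) :=
  {τ2 | IsKernel τ2 ∧ ∀ τ2' : M2 → (Fin n → V2) → ℝ,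
      IsKernel τ2' → d2N PU d2 σ τ2 ≤ d2N PU d2 σ τ2'}

/-- Worst-case encoder distortion over the best responses of the two decoders. -/
noncomputable def DeWorst (PU : U → ℝ) (de : U → V1 → V2 → ℝ) (d1 : U → V1 → ℝ)
    (d2 : U → V2 → ℝ) {n : ℕ} (σ : (Fin n → U) → M1 × M2 → ℝ) : ℝ :=
  sSup {y | ∃ τ1 ∈ BR1 PU d1 σ, ∃ τ2 ∈ BR2 PU d2 σ, y = deN PU de σ τ1 τ2}

end Operational

/-- Optimal `n`-letter encoder distortion `D_e^n(R1,R2)`. -/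
noncomputable def Dn {U V1 V2 : Type*} [Fintype U] [Fintype V1] [Fintype V2]
    (PU : U → ℝ) (de : U → V1 → V2 → ℝ) (d1 : U → V1 → ℝ) (d2 : U → V2 → ℝ)
    (R1 R2 : ℝ) (n : ℕ) : ℝ :=
  sInf {x | ∃ σ : (Fin n → U) → Msg R1 n × Msg R2 n → ℝ, IsKernel σ ∧
    x = DeWorst PU de d1 d2 σ}

section SingleLetter

variable {U V1 V2 W1 W2 : Type*} [Fintype U] [Fintype V1] [Fintype V2]
  [Fintype W1] [Fintype W2]

/-- The information-constraint set `Q0(R1,R2)` of conditional distributions. -/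
noncomputable def Q0set (PU : U → ℝ) (R1 R2 : ℝ) : Set (U → W1 × W2 → ℝ) :=
  {Q | IsKernel Q ∧
    miOfJoint (fun p : U × W2 => ∑ w1, PU p.1 * Q p.1 (w1, p.2)) ≤ R2 ∧
    miOfJoint (fun p : U × (W1 × W2) => PU p.1 * Q p.1 p.2) ≤ R1 + R2}

/-- Expected distortion `E[d_1(U,V1)]` under `P_U · Q_{W1W2|U} · Q_{V1|W1W2}`. -/
noncomputable def E1 (PU : U → ℝ) (d1 : U → V1 → ℝ) (Q : U → W1 × W2 → ℝ)
    (k1 : W1 × W2 → V1 → ℝ) : ℝ :=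
  ∑ u, ∑ w : W1 × W2, ∑ v1, PU u * Q u w * k1 w v1 * d1 u v1

/-- Expected distortion `E[d_2(U,V2)]` under `P_U · Q_{W2|U} · Q_{V2|W2}`. -/
noncomputable def E2 (PU : U → ℝ) (d2 : U → V2 → ℝ) (Q : U → W1 × W2 → ℝ)
    (k2 : W2 → V2 → ℝ) : ℝ :=
  ∑ u, ∑ w2 : W2, ∑ v2, PU u * (∑ w1, Q u (w1, w2)) * k2 w2 v2 * d2 u v2

/-- Single-letter best responses `Q1(Q_{W1W2|U})` of decoder 1. -/
def Q1set (PU : U → ℝ) (d1 : U → V1 → ℝ) (Q : U → W1 × W2 → ℝ) :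
    Set (W1 × W2 → V1 → ℝ) :=
  {k1 | IsKernel k1 ∧ ∀ k1' : W1 × W2 → V1 → ℝ, IsKernel k1' →
      E1 PU d1 Q k1 ≤ E1 PU d1 Q k1'}

/-- Single-letter best responses `Q2(Q_{W2|U})` of decoder 2. -/
def Q2set (PU : U → ℝ) (d2 : U → V2 → ℝ) (Q : U → W1 × W2 → ℝ) :
    Set (W2 → V2 → ℝ) :=
  {k2 | IsKernel k2 ∧ ∀ k2' : W2 → V2 → ℝ, IsKernel k2' →
      E2 PU d2 Q k2 ≤ E2 PU d2 Q k2'}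

/-- Expected encoder distortion `E[d_e(U,V1,V2)]` under
`P_U · Q_{W1W2|U} · Q_{V1|W1W2} · Q_{V2|W2}`. -/
noncomputable def Ee (PU : U → ℝ) (de : U → V1 → V2 → ℝ) (Q : U → W1 × W2 → ℝ)
    (k1 : W1 × W2 → V1 → ℝ) (k2 : W2 → V2 → ℝ) : ℝ :=
  ∑ u, ∑ w : W1 × W2, ∑ v1, ∑ v2,
    PU u * Q u w * k1 w v1 * k2 w.2 v2 * de u v1 v2

end SingleLetter

/-- Single-letter optimal encoder distortion `D_e*(R1,R2)`, with auxiliary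
alphabets `W1`, `W2`. -/
noncomputable def Dstar (W1 W2 : Type*) [Fintype W1] [Fintype W2]
    {U V1 V2 : Type*} [Fintype U] [Fintype V1] [Fintype V2]
    (PU : U → ℝ) (de : U → V1 → V2 → ℝ) (d1 : U → V1 → ℝ) (d2 : U → V2 → ℝ)
    (R1 R2 : ℝ) : ℝ :=
  sInf {x | ∃ Q : U → W1 × W2 → ℝ, Q ∈ Q0set PU R1 R2 ∧
    x = sSup {y | ∃ k1 ∈ Q1set PU d1 Q, ∃ k2 ∈ Q2set PU d2 Q,
      y = Ee PU de Q k1 k2}}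


/-- abstract expected cost -/
noncomputable def Lc {X Y V : Type*} [Fintype X] [Fintype Y] [Fintype V]
    (w : X → Y → ℝ) (c : X → V → ℝ) (τ : Y → V → ℝ) : ℝ :=
  ∑ x, ∑ y, ∑ v, w x y * τ y v * c x v

theorem Lc_reindex {X Y V X' Y' V' : Type*} [Fintype X] [Fintype Y] [Fintype V]
    [Fintype X'] [Fintype Y'] [Fintype V']
    (ex : X' ≃ X) (ey : Y' ≃ Y) (ev : V' ≃ V)
    (w : X → Y → ℝ) (c : X → V → ℝ) (τ : Y → V → ℝ) :
    Lc w c τ = Lc (fun x y => w (ex x) (ey y)) (fun x v => c (ex x) (ev v))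
      (fun y v => τ (ey y) (ev v)) := by
  unfold Lc
  rw [← Equiv.sum_comp ex]
  refine Finset.sum_congr rfl fun x _ => ?_
  rw [← Equiv.sum_comp ey]
  refine Finset.sum_congr rfl fun y _ => ?_
  rw [← Equiv.sum_comp ev]

theorem kernel_reindex {Y V Y' V' : Type*} [Fintype V] [Fintype V']
    (ey : Y' → Y) (ev : V' ≃ V) (τ : Y → V → ℝ) (h : IsKernel τ) :
    IsKernel (fun y v => τ (ey y) (ev v)) := by
  intro y
  refine ⟨fun v => (h _).1 _, ?_⟩
  rw [Equiv.sum_comp ev (fun v => τ (ey y) v)]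
  exact (h _).2

theorem kernel_prod {Y V Y' V' : Type*} [Fintype V] [Fintype V']
    (τ : Y → V → ℝ) (h : IsKernel τ) (τ' : Y' → V' → ℝ) (h' : IsKernel τ') :
    IsKernel (fun (y : Y × Y') (v : V × V') => τ y.1 v.1 * τ' y.2 v.2) := by
  intro y
  refine ⟨fun v => mul_nonneg ((h _).1 _) ((h' _).1 _), ?_⟩
  rw [Fintype.sum_prod_type]
  simp only [← Finset.mul_sum, (h' _).2, mul_one, (h _).2]

/-- marginal decoder -/
noncomputable def marg {Y V X' Y' V' : Type*}
    [Fintype X'] [Fintype Y'] [Fintype V'] (w' : X' → Y' → ℝ)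
    (T : Y × Y' → V × V' → ℝ) : Y → V → ℝ :=
  fun y v => ∑ x', ∑ y', ∑ v', w' x' y' * T (y, y') (v, v')

theorem marg_prod {Y V X' Y' V' : Type*}
    [Fintype X'] [Fintype Y'] [Fintype V'] (w' : X' → Y' → ℝ)
    (hw1 : ∑ x', ∑ y', w' x' y' = 1)
    (τ : Y → V → ℝ) (τ' : Y' → V' → ℝ) (h' : IsKernel τ') :
    marg w' (fun (y : Y × Y') (v : V × V') => τ y.1 v.1 * τ' y.2 v.2) = τ := by
  funext y v
  simp only [marg, ← Finset.mul_sum, (h' _).2, mul_one, ← Finset.sum_mul, hw1, one_mul]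

theorem marg_kernel {Y V X' Y' V' : Type*} [Fintype V]
    [Fintype X'] [Fintype Y'] [Fintype V'] (w' : X' → Y' → ℝ)
    (hw0 : ∀ x y, 0 ≤ w' x y) (hw1 : ∑ x', ∑ y', w' x' y' = 1)
    (T : Y × Y' → V × V' → ℝ) (hT : IsKernel T) : IsKernel (marg w' T) := by
  intro y
  refine ⟨fun v => Finset.sum_nonneg fun x' _ => Finset.sum_nonneg fun y' _ =>
    Finset.sum_nonneg fun v' _ => mul_nonneg (hw0 _ _) ((hT _).1 _), ?_⟩
  unfold marg
  rw [Finset.sum_comm, ← hw1]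
  refine Finset.sum_congr rfl fun x' _ => ?_
  rw [Finset.sum_comm]
  refine Finset.sum_congr rfl fun y' _ => ?_
  have := (hT (y, y')).2
  rw [Fintype.sum_prod_type] at this
  simp only [← Finset.mul_sum, this, mul_one]

theorem Lc_fst {X Y V X' Y' V' : Type*} [Fintype X] [Fintype Y] [Fintype V]
    [Fintype X'] [Fintype Y'] [Fintype V']
    (w : X → Y → ℝ) (c : X → V → ℝ) (w' : X' → Y' → ℝ)
    (T : Y × Y' → V × V' → ℝ) :
    Lc (fun (x : X × X') (y : Y × Y') => w x.1 y.1 * w' x.2 y.2)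
      (fun x (v : V × V') => c x.1 v.1) T = Lc w c (marg w' T) := by
  unfold Lc marg
  rw [Fintype.sum_prod_type]
  refine Finset.sum_congr rfl fun x _ => ?_
  simp only [Fintype.sum_prod_type]
  rw [Finset.sum_comm]
  refine Finset.sum_congr rfl fun y _ => ?_
  simp only [Finset.mul_sum, Finset.sum_mul]
  conv_rhs => rw [Finset.sum_comm]
  refine Finset.sum_congr rfl fun x' _ => ?_
  conv_rhs => rw [Finset.sum_comm]
  refine Finset.sum_congr rfl fun y' _ => ?_
  refine Finset.sum_congr rfl fun v _ => ?_
  refine Finset.sum_congr rfl fun v' _ => ?_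
  ring

theorem Lc_add {X Y V : Type*} [Fintype X] [Fintype Y] [Fintype V]
    (w : X → Y → ℝ) (c c' : X → V → ℝ) (τ : Y → V → ℝ) :
    Lc w (fun x v => c x v + c' x v) τ = Lc w c τ + Lc w c' τ := by
  simp only [Lc, mul_add, Finset.sum_add_distrib]

theorem Lc_snd {X Y V X' Y' V' : Type*} [Fintype X] [Fintype Y] [Fintype V]
    [Fintype X'] [Fintype Y'] [Fintype V']
    (w : X → Y → ℝ) (c' : X' → V' → ℝ) (w' : X' → Y' → ℝ)
    (T : Y × Y' → V × V' → ℝ) :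
    Lc (fun (x : X × X') (y : Y × Y') => w x.1 y.1 * w' x.2 y.2)
      (fun x (v : V × V') => c' x.2 v.2) T
      = Lc w' c' (marg w (fun y v => T y.swap v.swap)) := by
  rw [← Lc_fst, Lc_reindex (Equiv.prodComm _ _) (Equiv.prodComm _ _) (Equiv.prodComm _ _)]
  simp [mul_comm]

theorem Lc_opt {X Y V X' Y' V' : Type*} [Fintype X] [Fintype Y] [Fintype V]
    [Fintype X'] [Fintype Y'] [Fintype V']
    (w : X → Y → ℝ) (c : X → V → ℝ) (w' : X' → Y' → ℝ) (c' : X' → V' → ℝ)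
    (hw0 : ∀ x y, 0 ≤ w x y) (hw1 : ∑ x, ∑ y, w x y = 1)
    (hw0' : ∀ x y, 0 ≤ w' x y) (hw1' : ∑ x, ∑ y, w' x y = 1)
    (τ : Y → V → ℝ) (hτ : IsKernel τ) (τ' : Y' → V' → ℝ) (hτ' : IsKernel τ')
    (h : ∀ ρ, IsKernel ρ → Lc w c τ ≤ Lc w c ρ)
    (h' : ∀ ρ, IsKernel ρ → Lc w' c' τ' ≤ Lc w' c' ρ)
    (T : Y × Y' → V × V' → ℝ) (hT : IsKernel T) :
    Lc (fun (x : X × X') (y : Y × Y') => w x.1 y.1 * w' x.2 y.2)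
      (fun x (v : V × V') => c x.1 v.1 + c' x.2 v.2)
      (fun (y : Y × Y') (v : V × V') => τ y.1 v.1 * τ' y.2 v.2) ≤
    Lc (fun (x : X × X') (y : Y × Y') => w x.1 y.1 * w' x.2 y.2)
      (fun x (v : V × V') => c x.1 v.1 + c' x.2 v.2) T := by
  rw [Lc_add, Lc_add, Lc_fst, Lc_fst, Lc_snd, Lc_snd, marg_prod w' hw1' τ τ' hτ']
  have e := marg_prod w hw1 τ' τ hτ
  have e2 : (fun (y : Y' × Y) (v : V' × V) =>
      (fun (y : Y × Y') (v : V × V') => τ y.1 v.1 * τ' y.2 v.2) y.swap v.swap)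
      = fun (y : Y' × Y) (v : V' × V) => τ' y.1 v.1 * τ y.2 v.2 := by
    funext y v; simp [mul_comm]
  rw [e2, e]
  exact add_le_add (h _ (marg_kernel w' hw0' hw1' T hT))
    (h' _ (marg_kernel w hw0 hw1 _
      (kernel_reindex (Equiv.prodComm _ _) (Equiv.prodComm _ _) T hT)))

theorem d1N_eq {U V M1 M2 : Type*} [Fintype U] [Fintype V] [Fintype M1] [Fintype M2]
    (PU : U → ℝ) (d : U → V → ℝ) {n : ℕ} (σ : (Fin n → U) → M1 × M2 → ℝ)
    (τ : M1 × M2 → (Fin n → V) → ℝ) :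
    d1N PU d σ τ = (n : ℝ)⁻¹ * Lc (fun u y => (∏ t, PU (u t)) * σ u y)
      (fun u v => ∑ t, d (u t) (v t)) τ := by
  simp only [d1N, Lc, Fintype.sum_prod_type]
  simp only [Finset.mul_sum]
  refine Finset.sum_congr rfl fun u _ => Finset.sum_congr rfl fun m1 _ =>
    Finset.sum_congr rfl fun m2 _ => Finset.sum_congr rfl fun v _ =>
    Finset.sum_congr rfl fun t _ => by ring

theorem d2N_eq {U V M1 M2 : Type*} [Fintype U] [Fintype V] [Fintype M1] [Fintype M2]
    (PU : U → ℝ) (d : U → V → ℝ) {n : ℕ} (σ : (Fin n → U) → M1 × M2 → ℝ)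
    (τ : M2 → (Fin n → V) → ℝ) :
    d2N PU d σ τ = (n : ℝ)⁻¹ * Lc (fun u y => (∏ t, PU (u t)) * ∑ m1, σ u (m1, y))
      (fun u v => ∑ t, d (u t) (v t)) τ := by
  simp only [d2N, Lc]
  rw [Finset.mul_sum]
  refine Finset.sum_congr rfl fun u _ => ?_
  rw [Finset.sum_comm, Finset.mul_sum]
  refine Finset.sum_congr rfl fun m2 _ => ?_
  rw [Finset.sum_comm, Finset.mul_sum]
  refine Finset.sum_congr rfl fun v _ => ?_
  rw [← Finset.sum_mul, ← Finset.sum_mul, ← Finset.mul_sum]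
  ring

theorem sum_prod_PU {U : Type*} [Fintype U] (PU : U → ℝ) (h : IsDist PU) (n : ℕ) :
    ∑ u : Fin n → U, ∏ t, PU (u t) = 1 := by
  classical
  have := (Fintype.prod_sum (fun (_ : Fin n) (u : U) => PU u)).symm
  rw [this]; simp [h.2]

theorem prod_PU_append {U : Type*} (PU : U → ℝ) {n m : ℕ} (x : (Fin n → U) × (Fin m → U)) :
    ∏ t, PU (Fin.appendEquiv n m x t) = (∏ t, PU (x.1 t)) * ∏ t, PU (x.2 t) := by
  simp [Fin.prod_univ_add, Fin.appendEquiv]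

theorem sum_d_append {U V : Type*} (d : U → V → ℝ) {n m : ℕ} (x : (Fin n → U) × (Fin m → U))
    (v : (Fin n → V) × (Fin m → V)) :
    ∑ t, d (Fin.appendEquiv n m x t) (Fin.appendEquiv n m v t)
      = (∑ t, d (x.1 t) (v.1 t)) + ∑ t, d (x.2 t) (v.2 t) := by
  simp [Fin.sum_univ_add, Fin.appendEquiv]

/-- concatenating best responses to `σ^n` and `σ^m` yields a best
response to the concatenated encoding strategy `σ_c` at blocklength `n + m`. -/
theorem stmt1_concatenation_best_response
    {U V1 V2 : Type*} [Fintype U] [Fintype V1] [Fintype V2]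
    {M1n M2n M1m M2m : Type*} [Fintype M1n] [Fintype M2n] [Fintype M1m] [Fintype M2m]
    (PU : U → ℝ) (hPU : IsDist PU)
    (d1 : U → V1 → ℝ) (d2 : U → V2 → ℝ)
    (n m : ℕ) (hn : 1 ≤ n) (hm : 1 ≤ m)
    (σn : (Fin n → U) → M1n × M2n → ℝ) (hσn : IsKernel σn)
    (σm : (Fin m → U) → M1m × M2m → ℝ) (hσm : IsKernel σm)
    (τ1n : M1n × M2n → (Fin n → V1) → ℝ) (hτ1n : τ1n ∈ BR1 PU d1 σn)
    (τ1m : M1m × M2m → (Fin m → V1) → ℝ) (hτ1m : τ1m ∈ BR1 PU d1 σm)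
    (τ2n : M2n → (Fin n → V2) → ℝ) (hτ2n : τ2n ∈ BR2 PU d2 σn)
    (τ2m : M2m → (Fin m → V2) → ℝ) (hτ2m : τ2m ∈ BR2 PU d2 σm)
    -- the concatenated encoding strategy
    (σc : (Fin (n + m) → U) → (M1n × M1m) × (M2n × M2m) → ℝ)
    (hσc : σc = fun (u : Fin (n + m) → U) (mm : (M1n × M1m) × (M2n × M2m)) =>
        σn (fun i => u (Fin.castAdd m i)) (mm.1.1, mm.2.1) *
          σm (fun j => u (Fin.natAdd n j)) (mm.1.2, mm.2.2)) :
    -- the concatenated decoding strategies are best responses to `σ_c`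
    (fun (mm : (M1n × M1m) × (M2n × M2m)) (v1 : Fin (n + m) → V1) =>
        τ1n (mm.1.1, mm.2.1) (fun i => v1 (Fin.castAdd m i)) *
          τ1m (mm.1.2, mm.2.2) (fun j => v1 (Fin.natAdd n j))) ∈ BR1 PU d1 σc ∧
    (fun (m2 : M2n × M2m) (v2 : Fin (n + m) → V2) =>
        τ2n m2.1 (fun i => v2 (Fin.castAdd m i)) *
          τ2m m2.2 (fun j => v2 (Fin.natAdd n j))) ∈ BR2 PU d2 σc := by
  subst hσc
  have hp0 : ∀ (k : ℕ) (u : Fin k → U), 0 ≤ ∏ t, PU (u t) :=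
    fun k u => Finset.prod_nonneg fun t _ => hPU.1 _
  have hn' : (0 : ℝ) < (n : ℝ)⁻¹ := by positivity
  have hm' : (0 : ℝ) < (m : ℝ)⁻¹ := by positivity
  have hnm' : (0 : ℝ) ≤ ((n + m : ℕ) : ℝ)⁻¹ := by positivity
  constructor
  · obtain ⟨k1, o1⟩ := hτ1n
    obtain ⟨k2, o2⟩ := hτ1m
    simp only [d1N_eq, mul_le_mul_iff_right₀ hn', mul_le_mul_iff_right₀ hm'] at o1 o2
    constructor
    · have := kernel_reindex (Equiv.prodProdProdComm M1n M1m M2n M2m)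
        (Fin.appendEquiv (α := V1) n m).symm _ (kernel_prod _ k1 _ k2)
      exact this
    · intro T hT
      rw [d1N_eq, d1N_eq]
      refine mul_le_mul_of_nonneg_left ?_ hnm'
      rw [Lc_reindex (Fin.appendEquiv (α := U) n m) (Equiv.prodProdProdComm M1n M2n M1m M2m)
        (Fin.appendEquiv (α := V1) n m),
        Lc_reindex (Fin.appendEquiv (α := U) n m) (Equiv.prodProdProdComm M1n M2n M1m M2m)
        (Fin.appendEquiv (α := V1) n m) _ _ T]
      have key := Lc_opt
        (fun (u : Fin n → U) (y : M1n × M2n) => (∏ t, PU (u t)) * σn u y)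
        (fun (u : Fin n → U) (v : Fin n → V1) => ∑ t, d1 (u t) (v t)) (fun (u : Fin m → U) (y : M1m × M2m) => (∏ t, PU (u t)) * σm u y)
        (fun (u : Fin m → U) (v : Fin m → V1) => ∑ t, d1 (u t) (v t))
        (fun u y => mul_nonneg (hp0 _ _) ((hσn _).1 _))
        (by simp only [← Finset.mul_sum, (hσn _).2, mul_one, sum_prod_PU PU hPU])
        (fun u y => mul_nonneg (hp0 _ _) ((hσm _).1 _))
        (by simp only [← Finset.mul_sum, (hσm _).2, mul_one, sum_prod_PU PU hPU])
        τ1n k1 τ1m k2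
        o1 o2 _
        (kernel_reindex (Equiv.prodProdProdComm M1n M2n M1m M2m)
          (Fin.appendEquiv (α := V1) n m) T hT)
      simp only [sum_d_append, prod_PU_append]
      simp only [Fin.appendEquiv, Equiv.coe_fn_mk, Fin.append_left, Fin.append_right,
        Equiv.prodProdProdComm_apply] at key ⊢
      convert key using 4
      · rfl
      all_goals exact mul_mul_mul_comm _ _ _ _
  · obtain ⟨k1, o1⟩ := hτ2n
    obtain ⟨k2, o2⟩ := hτ2m
    simp only [d2N_eq, mul_le_mul_iff_right₀ hn', mul_le_mul_iff_right₀ hm'] at o1 o2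
    constructor
    · have := kernel_reindex (Equiv.refl (M2n × M2m))
        (Fin.appendEquiv (α := V2) n m).symm _ (kernel_prod _ k1 _ k2)
      exact this
    · intro T hT
      rw [d2N_eq, d2N_eq]
      refine mul_le_mul_of_nonneg_left ?_ hnm'
      rw [Lc_reindex (Fin.appendEquiv (α := U) n m) (Equiv.refl (M2n × M2m))
        (Fin.appendEquiv (α := V2) n m),
        Lc_reindex (Fin.appendEquiv (α := U) n m) (Equiv.refl (M2n × M2m))
        (Fin.appendEquiv (α := V2) n m) _ _ T]
      have hs : ∀ u, ∑ y, ∑ x, σn u (x, y) = 1 := fun u => by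
        rw [← (hσn u).2, Fintype.sum_prod_type_right]
      have hs' : ∀ u, ∑ y, ∑ x, σm u (x, y) = 1 := fun u => by
        rw [← (hσm u).2, Fintype.sum_prod_type_right]
      have key := Lc_opt
        (fun (u : Fin n → U) (y : M2n) => (∏ t, PU (u t)) * ∑ x, σn u (x, y))
        (fun (u : Fin n → U) (v : Fin n → V2) => ∑ t, d2 (u t) (v t)) (fun (u : Fin m → U) (y : M2m) => (∏ t, PU (u t)) * ∑ x, σm u (x, y))
        (fun (u : Fin m → U) (v : Fin m → V2) => ∑ t, d2 (u t) (v t))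
        (fun u y => mul_nonneg (hp0 _ _) (Finset.sum_nonneg fun _ _ => (hσn _).1 _))
        (by simp only [← Finset.mul_sum, hs, mul_one, sum_prod_PU PU hPU])
        (fun u y => mul_nonneg (hp0 _ _) (Finset.sum_nonneg fun _ _ => (hσm _).1 _))
        (by simp only [← Finset.mul_sum, hs', mul_one, sum_prod_PU PU hPU])
        τ2n k1 τ2m k2
        o1 o2 _
        (kernel_reindex (Equiv.refl (M2n × M2m))
          (Fin.appendEquiv (α := V2) n m) T hT)
      simp only [sum_d_append, prod_PU_append, Fintype.sum_prod_type]
      simp only [Fin.appendEquiv, Equiv.coe_fn_mk, Fin.append_left, Fin.append_right,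
        Equiv.refl_apply, ← Finset.mul_sum, ← Finset.sum_mul] at key ⊢
      convert key using 4
      · rfl
      all_goals exact mul_mul_mul_comm _ _ _ _

end Persuasion
end

section
/- Let σ be any encoding strategy at blocklength n, let T be uniform on {1,…,n} and independent of (U^n,M1,M2), and set U = U_T, W1 = (M1,T), W2 = (M2,T). Then R2 ≥ I(U;W2) and R1 + R2 ≥ I(U;W1,W2), where the mutual informations are computed under the induced joint law; consequently the induced conditional distribution P^σ_{W1W2|U} belongs to Q0(R1,R2). -/
open scoped BigOperators

namespace Persuasion

section InfoConstraints

variable {U M1 M2 : Type*} [Fintype U] [Fintype M1] [Fintype M2] [DecidableEq U]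

/-- Joint distribution of `(U_T, ((M1,T),(M2,T)))` where `T` is uniform on
`{1,…,n}` and independent of `(U^n, M1, M2)`. -/
noncomputable def slJointUW (PU : U → ℝ) {n : ℕ}
    (σ : (Fin n → U) → M1 × M2 → ℝ)
    (u : U) (w : (M1 × Fin n) × (M2 × Fin n)) : ℝ :=
  if w.1.2 = w.2.2 then
    (n : ℝ)⁻¹ * ∑ un : Fin n → U,
      (if un w.1.2 = u then (∏ t, PU (un t)) * σ un (w.1.1, w.2.1) else 0)
  else 0

end InfoConstraints

lemma mi_eq {α β : Type*} [Fintype α] [Fintype β] (p : α × β → ℝ) :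
    miOfJoint p = ∑ b, ∑ a, p (a, b) *
      (Real.logb 2 (p (a, b)) - Real.logb 2 (∑ b', p (a, b')) - Real.logb 2 (∑ a', p (a', b))) := by
  have h1 : ∑ a, (∑ b, p (a, b)) * Real.logb 2 (∑ b', p (a, b'))
      = ∑ b, ∑ a, p (a, b) * Real.logb 2 (∑ b', p (a, b')) := by
    rw [Finset.sum_comm]
    exact Finset.sum_congr rfl fun a _ => by rw [Finset.sum_mul]
  have h2 : ∑ b, (∑ a, p (a, b)) * Real.logb 2 (∑ a', p (a', b))
      = ∑ b, ∑ a, p (a, b) * Real.logb 2 (∑ a', p (a', b)) :=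
    Finset.sum_congr rfl fun a _ => by rw [Finset.sum_mul]
  have h3 : ∑ x, p x * Real.logb 2 (p x) = ∑ b, ∑ a, p (a, b) * Real.logb 2 (p (a, b)) := by
    rw [Fintype.sum_prod_type_right]
  unfold miOfJoint ent
  rw [h1, h2, h3]
  simp only [mul_sub, Finset.sum_sub_distrib]
  ring

lemma mi_inj {α β γ : Type*} [Fintype α] [Fintype β] [Fintype γ] (p : α × γ → ℝ)
    (e : β → γ) (he : Function.Injective e) (h0 : ∀ a, ∀ c ∉ Set.range e, p (a, c) = 0) :
    miOfJoint p = miOfJoint (fun x : α × β => p (x.1, e x.2)) := by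
  rw [mi_eq, mi_eq]
  symm
  apply Fintype.sum_of_injective e he
  · intro c hc
    simp [h0 _ c hc]
  · intro b
    have : ∀ a, ∑ b', p (a, e b') = ∑ c, p (a, c) := fun a =>
      Fintype.sum_of_injective e he _ _ (fun c hc => h0 a c hc) (fun _ => rfl)
    simp only [this]

/-- law of (U_t, M) -/
noncomputable def pt {U M : Type*} [Fintype U] [DecidableEq U] (PU : U → ℝ) {n : ℕ}
    (s : (Fin n → U) → M → ℝ) (t : Fin n) (u : U) (m : M) : ℝ :=
  ∑ un : Fin n → U, if un t = u then (∏ i, PU (un i)) * s un m else 0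

noncomputable def pM {U M : Type*} [Fintype U] (PU : U → ℝ) {n : ℕ}
    (s : (Fin n → U) → M → ℝ) (m : M) : ℝ :=
  ∑ un : Fin n → U, (∏ i, PU (un i)) * s un m

section
variable {U M : Type*} [Fintype U] [DecidableEq U] [Fintype M] {PU : U → ℝ} {n : ℕ}
  {s : (Fin n → U) → M → ℝ}

lemma sum_prod_one (hPU : IsDist PU) : ∑ un : Fin n → U, ∏ i, PU (un i) = 1 := by
  have := Finset.prod_univ_sum (fun _ : Fin n => (Finset.univ : Finset U)) (fun _ j => PU j)
  rw [Fintype.piFinset_univ] at this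
  rw [← this, hPU.2]; simp

lemma sum_prod_marg (hPU : IsDist PU) (t : Fin n) (u : U) :
    ∑ un : Fin n → U, (if un t = u then ∏ i, PU (un i) else 0) = PU u := by
  have := Finset.prod_univ_sum (fun _ : Fin n => (Finset.univ : Finset U))
    (fun i j => if i = t then (if j = u then PU u else 0) else PU j)
  rw [Fintype.piFinset_univ] at this
  have h1 : ∏ i : Fin n, ∑ j : U, (if i = t then (if j = u then PU u else 0) else PU j) = PU u := by
    rw [Finset.prod_eq_single t]
    · simp
    · intro b _ hb; simp [hb, hPU.2]
    · simp
  rw [h1] at this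
  rw [this]
  refine Finset.sum_congr rfl fun un _ => ?_
  split_ifs with h
  · refine Finset.prod_congr rfl fun i _ => ?_
    split_ifs with h1 h2
    · rw [h1, h]
    · exact absurd (h1 ▸ h) h2
    · rfl
  · symm
    apply Finset.prod_eq_zero (Finset.mem_univ t)
    simp [h]

lemma sum_pt_u (t : Fin n) (m : M) : ∑ u, pt PU s t u m = pM PU s m := by
  unfold pt pM
  rw [Finset.sum_comm]
  simp

lemma sum_pt_m (hPU : IsDist PU) (hs : IsKernel s) (t : Fin n) (u : U) :
    ∑ m, pt PU s t u m = PU u := by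
  unfold pt
  rw [Finset.sum_comm, ← sum_prod_marg hPU t u]
  refine Finset.sum_congr rfl fun un _ => ?_
  split_ifs
  · rw [← Finset.mul_sum, (hs un).2, mul_one]
  · simp

lemma p_nonneg (hPU : IsDist PU) (hs : IsKernel s) (un : Fin n → U) (m : M) :
    0 ≤ (∏ i, PU (un i)) * s un m :=
  mul_nonneg (Finset.prod_nonneg fun i _ => hPU.1 _) ((hs un).1 m)

lemma pt_nonneg (hPU : IsDist PU) (hs : IsKernel s) (t : Fin n) (u : U) (m : M) :
    0 ≤ pt PU s t u m := by
  unfold pt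
  refine Finset.sum_nonneg fun un _ => ?_
  split_ifs
  · exact p_nonneg hPU hs un m
  · exact le_rfl

lemma p_le_pt (hPU : IsDist PU) (hs : IsKernel s) (t : Fin n) (un : Fin n → U) (m : M) :
    (∏ i, PU (un i)) * s un m ≤ pt PU s t (un t) m := by
  unfold pt
  have := Finset.single_le_sum (s := Finset.univ)
    (f := fun vn : Fin n → U => if vn t = un t then (∏ i, PU (vn i)) * s vn m else 0)
    (fun vn _ => by
      split_ifs
      · exact p_nonneg hPU hs vn m
      · exact le_rfl) (Finset.mem_univ un)
  simpa using this

lemma pt_le_pM (hPU : IsDist PU) (hs : IsKernel s) (t : Fin n) (u : U) (m : M) :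
    pt PU s t u m ≤ pM PU s m := by
  rw [← sum_pt_u t m]
  exact Finset.single_le_sum (f := fun u => pt PU s t u m)
    (fun v _ => pt_nonneg hPU hs t v m) (Finset.mem_univ u)

/-- the Gibbs inequality step -/
lemma gibbs (hn : 1 ≤ n) (hPU : IsDist PU) (hs : IsKernel s) (hM : 0 < Fintype.card M) :
    ∑ m, ∑ un : Fin n → U, (∏ i, PU (un i)) * s un m *
      ∑ t, (Real.log (pt PU s t (un t) m) - Real.log (PU (un t)) - Real.log (pM PU s m))
      ≤ Real.log (Fintype.card M) := by
  have hc : (0:ℝ) < Fintype.card M := by exact_mod_cast hM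
  set c : ℝ := (Fintype.card M : ℝ) with hcdef
  have key : ∀ m, ∀ un : Fin n → U, (∏ i, PU (un i)) * s un m *
      ∑ t, (Real.log (pt PU s t (un t) m) - Real.log (PU (un t)) - Real.log (pM PU s m))
      ≤ (∏ t, pt PU s t (un t) m / pM PU s m) / c - (∏ i, PU (un i)) * s un m
        + (∏ i, PU (un i)) * s un m * Real.log c := by
    intro m un
    have hM0 : 0 ≤ pM PU s m := (p_nonneg hPU hs un m).trans
      ((p_le_pt hPU hs ⟨0, hn⟩ un m).trans (pt_le_pM hPU hs _ _ m))
    have hr : 0 ≤ (∏ t, pt PU s t (un t) m / pM PU s m) / c :=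
      div_nonneg (Finset.prod_nonneg fun t _ => div_nonneg (pt_nonneg hPU hs _ _ _) hM0) hc.le
    rcases (p_nonneg hPU hs un m).eq_or_lt with h | h
    · rw [← h]; simpa using hr
    have hpt : ∀ t, 0 < pt PU s t (un t) m := fun t => h.trans_le (p_le_pt hPU hs t un m)
    have hpM : 0 < pM PU s m := (hpt ⟨0, hn⟩).trans_le (pt_le_pM hPU hs _ _ _)
    have hP0 : 0 ≤ ∏ i, PU (un i) := Finset.prod_nonneg fun i _ => hPU.1 _
    have hP : ∏ i, PU (un i) ≠ 0 := fun h0 => by simp [h0] at h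
    have hPpos := lt_of_le_of_ne hP0 (Ne.symm hP)
    have hPt : ∀ t, PU (un t) ≠ 0 := fun t h0 => hP (Finset.prod_eq_zero (Finset.mem_univ t) h0)
    have hrpos : 0 < ∏ t, pt PU s t (un t) m / pM PU s m :=
      Finset.prod_pos fun t _ => div_pos (hpt t) hpM
    have hlog : ∑ t, (Real.log (pt PU s t (un t) m) - Real.log (PU (un t)) - Real.log (pM PU s m))
        = Real.log ((∏ t, pt PU s t (un t) m / pM PU s m) / c / ∏ i, PU (un i)) + Real.log c := by
      rw [Real.log_div (div_pos hrpos hc).ne' hP, Real.log_div hrpos.ne' hc.ne',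
        Real.log_prod (fun t _ => (div_pos (hpt t) hpM).ne'), Real.log_prod (fun t _ => hPt t)]
      rw [sub_right_comm, sub_add_cancel, ← Finset.sum_sub_distrib]
      refine Finset.sum_congr rfl fun t _ => ?_
      rw [Real.log_div (hpt t).ne' hpM.ne']; ring
    have hs1 : s un m ≤ 1 := by
      rw [← (hs un).2]
      exact Finset.single_le_sum (fun a _ => (hs un).1 a) (Finset.mem_univ m)
    rw [hlog]
    set r := (∏ t, pt PU s t (un t) m / pM PU s m) / c
    have hle := Real.log_le_sub_one_of_pos (x := r / ∏ i, PU (un i)) (div_pos (div_pos hrpos hc) hPpos)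
    have h2 := mul_le_mul_of_nonneg_left hle h.le
    have h3 : (∏ i, PU (un i)) * s un m * (r / ∏ i, PU (un i) - 1)
        = s un m * r - (∏ i, PU (un i)) * s un m := by
      field_simp
    have h4 : s un m * r ≤ r := mul_le_of_le_one_left hr hs1
    rw [mul_add]
    linarith
  have hsum1 : ∑ m, ∑ un : Fin n → U, (∏ i, PU (un i)) * s un m = 1 := by
    rw [Finset.sum_comm, ← sum_prod_one (n := n) hPU]
    refine Finset.sum_congr rfl fun un _ => ?_
    rw [← Finset.mul_sum, (hs un).2, mul_one]
  have hsumr : ∀ m, ∑ un : Fin n → U, ∏ t, pt PU s t (un t) m / pM PU s m ≤ 1 := by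
    intro m
    have := Finset.prod_univ_sum (fun _ : Fin n => (Finset.univ : Finset U))
      (fun t u => pt PU s t u m / pM PU s m)
    rw [Fintype.piFinset_univ] at this
    rw [← this]
    simp only [← Finset.sum_div, sum_pt_u]
    refine Finset.prod_le_one (fun _ _ => ?_) (fun _ _ => div_self_le_one _)
    by_cases h : pM PU s m = 0
    · simp [h]
    · simp [div_self h]
  calc _ ≤ ∑ m, ∑ un : Fin n → U, ((∏ t, pt PU s t (un t) m / pM PU s m) / c
        - (∏ i, PU (un i)) * s un m + (∏ i, PU (un i)) * s un m * Real.log c) :=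
        Finset.sum_le_sum fun m _ => Finset.sum_le_sum fun un _ => key m un
    _ = (∑ m, (∑ un : Fin n → U, ∏ t, pt PU s t (un t) m / pM PU s m) / c) - 1
        + 1 * Real.log c := by
        simp only [Finset.sum_add_distrib, Finset.sum_sub_distrib, ← Finset.sum_div,
          ← Finset.sum_mul, hsum1]
    _ ≤ (∑ m : M, 1 / c) - 1 + 1 * Real.log c := by
        gcongr with m
        exact hsumr m
    _ = Real.log c := by
        simp [← hcdef, hc.ne']

lemma mi_main (hn : 1 ≤ n) (hPU : IsDist PU) (hs : IsKernel s) (hM : 0 < Fintype.card M) :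
    miOfJoint (fun p : U × (M × Fin n) => (n:ℝ)⁻¹ * pt PU s p.2.2 p.1 p.2.1)
      ≤ (n:ℝ)⁻¹ * Real.logb 2 (Fintype.card M) := by
  have hn0 : (n:ℝ) ≠ 0 := by positivity
  have hm : ∀ u, ∑ b : M × Fin n, (n:ℝ)⁻¹ * pt PU s b.2 u b.1 = PU u := by
    intro u
    rw [Fintype.sum_prod_type_right]
    simp only [← Finset.mul_sum, sum_pt_m hPU hs]
    simp [hn0]
  rw [mi_eq]
  simp only [hm, ← Finset.mul_sum, sum_pt_u]
  have h1 : ∀ (b : M × Fin n) (u : U), (n:ℝ)⁻¹ * pt PU s b.2 u b.1 *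
      (Real.logb 2 ((n:ℝ)⁻¹ * pt PU s b.2 u b.1) - Real.logb 2 (PU u)
        - Real.logb 2 ((n:ℝ)⁻¹ * pM PU s b.1)) =
      (n:ℝ)⁻¹ * (pt PU s b.2 u b.1 * (Real.log (pt PU s b.2 u b.1) - Real.log (PU u)
        - Real.log (pM PU s b.1)) / Real.log 2) := by
    intro b u
    rcases (pt_nonneg hPU hs b.2 u b.1).eq_or_lt with h | h
    · simp [← h]
    have h' := h.trans_le (pt_le_pM hPU hs b.2 u b.1)
    unfold Real.logb
    rw [Real.log_mul (inv_ne_zero hn0) h.ne', Real.log_mul (inv_ne_zero hn0) h'.ne']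
    ring
  simp only [h1, ← Finset.mul_sum, ← Finset.sum_div]
  unfold Real.logb
  have hl : 0 < Real.log 2 := Real.log_pos one_lt_two
  gcongr
  refine le_trans (le_of_eq ?_) (gibbs hn hPU hs hM)
  rw [Fintype.sum_prod_type]
  refine Finset.sum_congr rfl fun m _ => ?_
  simp only [Finset.mul_sum]
  rw [Finset.sum_comm (s := (Finset.univ : Finset (Fin n → U)))]
  refine Finset.sum_congr rfl fun t _ => ?_
  have : ∀ F : U → ℝ, ∑ u, pt PU s t u m * F u
      = ∑ un : Fin n → U, (∏ i, PU (un i)) * s un m * F (un t) := by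
    intro F
    unfold pt
    simp only [Finset.sum_mul]
    rw [Finset.sum_comm]
    simp [ite_mul]
  exact this (fun u => Real.log (pt PU s t u m) - Real.log (PU u) - Real.log (pM PU s m))

end

lemma logb_card (R : ℝ) (hR : 0 ≤ R) (n : ℕ) (hn : 1 ≤ n) :
    (n:ℝ)⁻¹ * Real.logb 2 (Fintype.card (Msg R n)) ≤ R := by
  have hn0 : (0:ℝ) < n := by positivity
  have h := Nat.floor_le (mul_nonneg hn0.le hR)
  have h2 : Real.logb 2 (Fintype.card (Msg R n)) = ⌊(n : ℝ) * R⌋₊ := by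
    rw [Fintype.card_fin, Nat.cast_pow, Nat.cast_ofNat, Real.logb_pow, Real.logb_self_eq_one one_lt_two,
      mul_one]
  rw [h2, inv_mul_le_iff₀ hn0]
  exact h

/-- for any encoding strategy `σ`, with `W1 = (M1,T)`,
`W2 = (M2,T)`, one has `R2 ≥ I(U;W2)` and `R1 + R2 ≥ I(U;W1,W2)`;
consequently the induced conditional distribution `P^σ_{W1W2|U}` belongs to
`Q0(R1,R2)`. -/
theorem stmt6_info_constraints
    {U : Type*} [Fintype U] [DecidableEq U]
    (PU : U → ℝ) (hPU : IsDist PU)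
    (R1 R2 : ℝ) (hR1 : 0 ≤ R1) (hR2 : 0 ≤ R2)
    (n : ℕ) (hn : 1 ≤ n)
    (σ : (Fin n → U) → Msg R1 n × Msg R2 n → ℝ) (hσ : IsKernel σ) :
    miOfJoint (fun p : U × (Msg R2 n × Fin n) =>
        ∑ w1 : Msg R1 n × Fin n, slJointUW PU σ p.1 (w1, p.2)) ≤ R2 ∧
    miOfJoint (fun p : U × ((Msg R1 n × Fin n) × (Msg R2 n × Fin n)) =>
        slJointUW PU σ p.1 p.2) ≤ R1 + R2 ∧
    ∃ Q : U → (Msg R1 n × Fin n) × (Msg R2 n × Fin n) → ℝ,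
      Q ∈ Q0set PU R1 R2 ∧ ∀ u w, PU u * Q u w = slJointUW PU σ u w := by
  have hc1 : 0 < Fintype.card (Msg R1 n) := by simp
  have hc2 : 0 < Fintype.card (Msg R2 n) := by simp
  have hn0 : (n:ℝ) ≠ 0 := by positivity
  have hA : miOfJoint (fun p : U × (Msg R2 n × Fin n) =>
        ∑ w1 : Msg R1 n × Fin n, slJointUW PU σ p.1 (w1, p.2)) ≤ R2 := by
    let s : (Fin n → U) → Msg R2 n → ℝ := fun un m2 => ∑ m1, σ un (m1, m2)
    have hs : IsKernel s := fun un => by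
      refine ⟨fun m2 => Finset.sum_nonneg fun m1 _ => (hσ un).1 _, ?_⟩
      rw [← (hσ un).2, Fintype.sum_prod_type_right]
    refine le_trans (le_of_eq ?_) ((mi_main hn hPU hs hc2).trans (logb_card R2 hR2 n hn))
    congr 1
    funext p
    simp only [slJointUW, Fintype.sum_prod_type, Finset.sum_ite_eq', Finset.mem_univ, if_true]
    rw [← Finset.mul_sum, Finset.sum_comm]
    unfold pt
    congr 1
    refine Finset.sum_congr rfl fun un _ => ?_
    split_ifs
    · rw [← Finset.mul_sum]
    · simp
  have hdiag : ∀ u (x : (Msg R1 n × Msg R2 n) × Fin n),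
      slJointUW PU σ u ((x.1.1, x.2), (x.1.2, x.2)) = (n:ℝ)⁻¹ * pt PU σ x.2 u x.1 := by
    intro u x
    simp [slJointUW, pt]
  let e : (Msg R1 n × Msg R2 n) × Fin n → (Msg R1 n × Fin n) × (Msg R2 n × Fin n) :=
    fun x => ((x.1.1, x.2), (x.1.2, x.2))
  have he : Function.Injective e := by
    rintro ⟨⟨a, b⟩, t⟩ ⟨⟨a', b'⟩, t'⟩ h
    simp only [e, Prod.mk.injEq] at h ⊢
    tauto
  have hoff : ∀ u, ∀ w ∉ Set.range e, slJointUW PU σ u w = 0 := by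
    rintro u ⟨⟨a, t⟩, ⟨b, t'⟩⟩ h
    unfold slJointUW
    rw [if_neg]
    intro h'
    simp only at h'
    subst h'
    exact h ⟨((a, b), t), rfl⟩
  have hB : miOfJoint (fun p : U × ((Msg R1 n × Fin n) × (Msg R2 n × Fin n)) =>
        slJointUW PU σ p.1 p.2) ≤ R1 + R2 := by
    rw [mi_inj _ e he (fun a c hc => hoff a c hc)]
    simp only [e, hdiag]
    refine (mi_main hn hPU hσ (by rw [Fintype.card_prod]; positivity)).trans ?_
    rw [Fintype.card_prod, Nat.cast_mul, Real.logb_mul (by positivity) (by positivity), mul_add]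
    exact add_le_add (logb_card R1 hR1 n hn) (logb_card R2 hR2 n hn)
  refine ⟨hA, hB, ?_⟩
  have hnn : ∀ u w, 0 ≤ slJointUW PU σ u w := by
    intro u w
    by_cases h : w ∈ Set.range e
    · obtain ⟨x, rfl⟩ := h
      simp only [e, hdiag]
      exact mul_nonneg (by positivity) (pt_nonneg hPU hσ _ _ _)
    · rw [hoff u w h]
  have hsum : ∀ u, ∑ w, slJointUW PU σ u w = PU u := by
    intro u
    rw [← Fintype.sum_of_injective e he (fun x => slJointUW PU σ u (e x)) _
      (fun w hw => hoff u w hw) (fun _ => rfl)]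
    simp only [e, hdiag]
    rw [Fintype.sum_prod_type_right]
    simp only [← Finset.mul_sum, sum_pt_m hPU hσ]
    simp [hn0]
  have hcW : ((Fintype.card ((Msg R1 n × Fin n) × (Msg R2 n × Fin n)) : ℕ) : ℝ) ≠ 0 := by
    simp only [Fintype.card_prod, Fintype.card_fin]
    positivity
  let Q : U → (Msg R1 n × Fin n) × (Msg R2 n × Fin n) → ℝ := fun u w =>
    if PU u = 0 then ((Fintype.card ((Msg R1 n × Fin n) × (Msg R2 n × Fin n)) : ℕ) : ℝ)⁻¹
    else slJointUW PU σ u w / PU u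
  have hQ : ∀ u w, PU u * Q u w = slJointUW PU σ u w := by
    intro u w
    by_cases h : PU u = 0
    · have h1 := hsum u
      rw [h, Finset.sum_eq_zero_iff_of_nonneg (fun w _ => hnn u w)] at h1
      rw [h, zero_mul, h1 w (Finset.mem_univ _)]
    · simp only [Q, if_neg h]
      field_simp
  refine ⟨Q, ⟨?_, ?_, ?_⟩, hQ⟩
  · intro u
    by_cases h : PU u = 0
    · simp only [Q, if_pos h]
      refine ⟨fun _ => by positivity, ?_⟩
      rw [Finset.sum_const, Finset.card_univ, nsmul_eq_mul, mul_inv_cancel₀ hcW]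
    · simp only [Q, if_neg h]
      refine ⟨fun w => div_nonneg (hnn u w) (hPU.1 u), ?_⟩
      rw [← Finset.sum_div, hsum, div_self h]
  · simp only [hQ]; exact hA
  · simp only [hQ]; exact hB

end Persuasion
end
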